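/- Let C, D ⊂ ℝ^d be polyhedral convex cones, A, B conic Borel sets, F an i-dimensional face of C, G a j-dimensional face of D, with i + j = d + k and k > 0. If F and G intersect transversely, then φ_{F∩G}(C ∩ D, A ∩ B) = Φ_k(F ∩ G, A ∩ B) · V_{d−k}(N(C,F) + N(D,G)). -/

import Mathlib

open MeasureTheory Set
open scoped ENNReal RealInnerProductSpace Pointwise

noncomputable section

/-- Abbreviation for Euclidean space `ℝ^d`. -/
abbrev Euc (d : ℕ) := EuclideanSpace ℝ (Fin d)

/-- The rotation group `SO(d)`, as a subgroup of the orthogonal group. -/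
def SOG (d : ℕ) : Subgroup (Matrix.orthogonalGroup (Fin d) ℝ) where
  carrier := {A | (A : Matrix (Fin d) (Fin d) ℝ).det = 1}
  one_mem' := Matrix.det_one
  mul_mem' := by
    intro a b ha hb
    simp only [Set.mem_setOf_eq] at *
    rw [show ((a * b : Matrix.orthogonalGroup (Fin d) ℝ) : Matrix (Fin d) (Fin d) ℝ)
        = (a : Matrix (Fin d) (Fin d) ℝ) * (b : Matrix (Fin d) (Fin d) ℝ) from rfl,
      Matrix.det_mul, ha, hb, mul_one]
  inv_mem' := by
    intro a ha
    simp only [Set.mem_setOf_eq] at *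
    rw [show ((a⁻¹ : Matrix.orthogonalGroup (Fin d) ℝ) : Matrix (Fin d) (Fin d) ℝ)
        = star (a : Matrix (Fin d) (Fin d) ℝ) from rfl]
    rw [Matrix.star_eq_conjTranspose, Matrix.det_conjTranspose, ha, star_one]

instance (d : ℕ) : MeasurableSpace (SOG d) := borel _

/-- A rotation `ϑ ∈ SO(d)`, as a linear map on `ℝ^d`. -/
def rotLin {d : ℕ} (ϑ : SOG d) : Euc d →ₗ[ℝ] Euc d :=
  ((EuclideanSpace.equiv (Fin d) ℝ).symm.toLinearEquiv.toLinearMap.comp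
    (Matrix.mulVecLin (ϑ : Matrix (Fin d) (Fin d) ℝ))).comp
    (EuclideanSpace.equiv (Fin d) ℝ).toLinearEquiv.toLinearMap

/-- The action of a rotation `ϑ ∈ SO(d)` on `ℝ^d`. -/
def rot {d : ℕ} (ϑ : SOG d) : Euc d → Euc d := rotLin ϑ

variable {d : ℕ}

/-- The standard Gaussian probability measure `γ_d` on `ℝ^d`. -/
def stdGauss (d : ℕ) : Measure (Euc d) :=
  volume.withDensity fun x =>
    ENNReal.ofReal ((2 * Real.pi) ^ (-(d : ℝ) / 2) * Real.exp (-‖x‖ ^ 2 / 2))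

/-- The standard Gaussian measure `γ_L` of a linear subspace `L` of `ℝ^d`, viewed as a measure
on `ℝ^d` concentrated on `L`. -/
def gauss (L : Submodule ℝ (Euc d)) : Measure (Euc d) :=
  Measure.map (Subtype.val) <|
    (volume : Measure L).withDensity fun x =>
      ENNReal.ofReal ((2 * Real.pi) ^ (-(Module.finrank ℝ L : ℝ) / 2) *
        Real.exp (-‖(x : Euc d)‖ ^ 2 / 2))

/-- A set is conic if it is stable under multiplication by positive scalars. -/
def IsConic (A : Set (Euc d)) : Prop := ∀ a ∈ A, ∀ r : ℝ, 0 < r → r • a ∈ A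

/-- A polyhedral (convex) cone: an intersection of finitely many closed halfspaces bounded by
linear hyperplanes (the empty intersection being all of `ℝ^d`). -/
def IsPolyCone (C : Set (Euc d)) : Prop :=
  ∃ U : Finset (Euc d), C = ⋂ u ∈ U, {x | ⟪u, x⟫ ≤ 0}

/-- `F` is a face of the convex set `C`: a nonempty convex extreme subset. -/
def IsFace (C F : Set (Euc d)) : Prop := IsExtreme ℝ C F ∧ Convex ℝ F ∧ F.Nonempty

/-- The linear hull `L(F)` of a set `F`. -/
def linHull (F : Set (Euc d)) : Submodule ℝ (Euc d) := Submodule.span ℝ F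

/-- The dimension of a face (or cone) `F`, i.e. the dimension of its linear hull. -/
def dimS (F : Set (Euc d)) : ℕ := Module.finrank ℝ (linHull F)

/-- `F` is a `k`-dimensional face of `C`. -/
def IsFaceDim (C F : Set (Euc d)) (k : ℕ) : Prop := IsFace C F ∧ dimS F = k

/-- The normal cone `N(C,F)` of the cone `C` at its face `F`. -/
def normalCone (C F : Set (Euc d)) : Set (Euc d) :=
  {u | (∀ y ∈ C, ⟪u, y⟫ ≤ 0) ∧ ∀ x ∈ F, ⟪u, x⟫ = 0}

/-- The conic curvature measure `Φ_k(C, A)` of a polyhedral cone `C`, evaluated at `A`: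
`Φ_k(C,A) = ∑_{F ∈ 𝓕_k(C)} γ_{L(F)}(F ∩ A) ⬝ γ_{L(F)^⊥}(N(C,F))`. -/
def Phi (k : ℕ) (C A : Set (Euc d)) : ℝ≥0∞ :=
  ∑' F : {F : Set (Euc d) // IsFaceDim C F k},
    gauss (linHull F.1) (F.1 ∩ A) * gauss (linHull F.1)ᗮ (normalCone C F.1)

/-- The conic intrinsic volume `V_k(C) = ∑_{F ∈ 𝓕_k(C)} γ_d(F + N(C,F))`. -/
def cV (k : ℕ) (C : Set (Euc d)) : ℝ≥0∞ :=
  ∑' F : {F : Set (Euc d) // IsFaceDim C F k},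
    stdGauss d (F.1 + normalCone C F.1)

/-- The localization `φ_F(C,A) = γ_d((A ∩ F) + N(C,F))` of `v_F(C)`. -/
def phiLoc (C F A : Set (Euc d)) : ℝ≥0∞ := stdGauss d ((A ∩ F) + normalCone C F)

/-- `C` is (the underlying set of) a linear subspace of `ℝ^d`. -/
def IsLinSubspace (C : Set (Euc d)) : Prop := ∃ L : Submodule ℝ (Euc d), (L : Set (Euc d)) = C

/-- Two polyhedral cones intersect transversely: `dim (F ∩ G) = dim F + dim G − d` and the
relative interiors meet. -/
def Transverse (F G : Set (Euc d)) : Prop :=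
  (dimS (F ∩ G) : ℤ) = (dimS F : ℤ) + (dimS G : ℤ) - d ∧
    (intrinsicInterior ℝ F ∩ intrinsicInterior ℝ G).Nonempty

/-- The volume of the parallelepiped spanned by the union of orthonormal bases of `L₁` and `L₂`
(the square root of the Gram determinant of the combined family). -/
def gramVol (L₁ L₂ : Submodule ℝ (Euc d)) : ℝ :=
  Real.sqrt (Matrix.det (Matrix.of fun i j :
      Fin (Module.finrank ℝ L₁) ⊕ Fin (Module.finrank ℝ L₂) =>
    ⟪Sum.elim (fun a => ((stdOrthonormalBasis ℝ L₁) a : Euc d))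
        (fun b => ((stdOrthonormalBasis ℝ L₂) b : Euc d)) i,
      Sum.elim (fun a => ((stdOrthonormalBasis ℝ L₁) a : Euc d))
        (fun b => ((stdOrthonormalBasis ℝ L₂) b : Euc d)) j⟫))

/-- The generalized sine function `[L₁, L₂]` of two subspaces. -/
def genSine (L₁ L₂ : Submodule ℝ (Euc d)) : ℝ :=
  if Module.finrank ℝ L₁ + Module.finrank ℝ L₂ ≤ d then gramVol L₁ L₂ else gramVol L₁ᗮ L₂ᗮ

/-- The generalized sine function `[C, D] = [L(C), L(D)]` of two cones. -/
def genSineC (C D : Set (Euc d)) : ℝ := genSine (linHull C) (linHull D)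

/-- Spherical Lebesgue measure `σ_{d-1}` on the unit sphere of `ℝ^d`. -/
def sphLebesgue (d : ℕ) : Measure (Metric.sphere (0 : Euc d) 1) :=
  (volume : Measure (Euc d)).toSphere

/-- The normalized spherical Lebesgue measure `σ = σ_{d-1}/ω_d` on the unit sphere. -/
def sphNormalized (d : ℕ) : Measure (Metric.sphere (0 : Euc d) 1) :=
  (sphLebesgue d Set.univ)⁻¹ • sphLebesgue d

/-- The Schläfli cones induced by the hyperplanes `(u i)^⊥`, `i = 1, …, n`: the closures of the
connected components of the complement of the union of the hyperplanes. -/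
def schlafliCones {n : ℕ} (u : Fin n → Euc d) : Set (Set (Euc d)) :=
  {C | ∃ x : Euc d, (∀ i, ⟪u i, x⟫ ≠ 0) ∧
    C = closure (connectedComponentIn {y : Euc d | ∀ i, ⟪u i, y⟫ ≠ 0} x)}

/-- `C(n,d) = 2 ∑_{r=0}^{d-1} binom(n-1, r)`, the number of Schläfli cones induced by `n`
hyperplanes in general position. -/
def schlafliCount (n d : ℕ) : ℕ := 2 * ∑ r ∈ Finset.range d, (n - 1).choose r

/-- The joint distribution `σ^n` of the unit normal vectors of `n` independent isotropic random
hyperplanes. -/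
def sphPi (d n : ℕ) : Measure (Fin n → Metric.sphere (0 : Euc d) 1) :=
  Measure.pi fun _ => sphNormalized d

end

section Farkas

variable {E : Type*} [NormedAddCommGroup E] [InnerProductSpace ℝ E]

/-- Farkas' lemma for finitely many vectors. -/
theorem exists_nonneg_sum_of_inner_nonpos {ι : Type*} (s : Finset ι) (a : ι → E) (b : E)
    (h : ∀ x, (∀ i ∈ s, ⟪a i, x⟫ ≤ 0) → ⟪b, x⟫ ≤ 0) :
    ∃ c : ι → ℝ, (∀ i, 0 ≤ c i) ∧ b = ∑ i ∈ s, c i • a i := by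
  classical
  induction s using Finset.induction_on generalizing a b with
  | empty =>
    refine ⟨0, fun _ => le_rfl, ?_⟩
    have := h b (by simp)
    simpa using this
  | insert m s hm ih =>
    by_cases hb : ∀ x, (∀ i ∈ s, ⟪a i, x⟫ ≤ 0) → ⟪b, x⟫ ≤ 0
    · obtain ⟨c, hc, hbc⟩ := ih a b hb
      refine ⟨Function.update c m 0, fun i => ?_, ?_⟩
      · by_cases him : i = m
        · subst him; simp
        · simp [him, hc i]
      · rw [Finset.sum_insert hm, Function.update_self, zero_smul, zero_add, hbc]
        refine Finset.sum_congr rfl fun i hi => ?_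
        rw [Function.update_of_ne (by rintro rfl; exact hm hi)]
    · push Not at hb
      obtain ⟨x₀, hx₀, hbx₀⟩ := hb
      have hmx₀ : 0 < ⟪a m, x₀⟫ := by
        by_contra! hle
        exact absurd (h x₀ (by simpa [Finset.forall_mem_insert] using ⟨hle, hx₀⟩)) hbx₀.not_ge
      set t := ⟪a m, x₀⟫ with ht
      obtain ⟨c, hc, hbc⟩ := ih (fun i => a i - (⟪a i, x₀⟫ / t) • a m)
        (b - (⟪b, x₀⟫ / t) • a m) (by
          intro x hx
          have hy := h (x - (⟪a m, x⟫ / t) • x₀) (by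
            intro i hi
            rw [inner_sub_right, inner_smul_right]
            rcases Finset.mem_insert.1 hi with rfl | hi
            · rw [← ht, div_mul_cancel₀ _ hmx₀.ne', sub_self]
            · have := hx i hi
              rw [inner_sub_left, real_inner_smul_left] at this
              calc _ = ⟪a i, x⟫ - ⟪a i, x₀⟫ / t * ⟪a m, x⟫ := by ring
                _ ≤ 0 := this)
          rw [inner_sub_right, inner_smul_right] at hy
          rw [inner_sub_left, real_inner_smul_left]
          calc _ = ⟪b, x⟫ - ⟪a m, x⟫ / t * ⟪b, x₀⟫ := by ring
            _ ≤ 0 := hy)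
      refine ⟨Function.update c m (⟪b, x₀⟫ / t - ∑ i ∈ s, c i * (⟪a i, x₀⟫ / t)), fun i => ?_, ?_⟩
      · by_cases him : i = m
        · subst him
          rw [Function.update_self, sub_nonneg]
          refine le_trans (Finset.sum_nonpos fun j hj => ?_) (by positivity)
          exact mul_nonpos_of_nonneg_of_nonpos (hc j)
            (div_nonpos_of_nonpos_of_nonneg (hx₀ j hj) hmx₀.le)
        · simp [him, hc i]
      · rw [Finset.sum_insert hm, Function.update_self]
        have hsum : ∑ i ∈ s, Function.update c m
            (⟪b, x₀⟫ / t - ∑ i ∈ s, c i * (⟪a i, x₀⟫ / t)) i • a i = ∑ i ∈ s, c i • a i :=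
          Finset.sum_congr rfl fun i hi => by
            rw [Function.update_of_ne (by rintro rfl; exact hm hi)]
        rw [hsum]
        refine (eq_add_of_sub_eq hbc).trans ?_
        simp only [smul_sub, smul_smul, Finset.sum_sub_distrib, sub_smul, Finset.sum_smul]
        abel

end Farkas

/-- The polar of an intersection of two polyhedral cones is the sum of their polars. -/
theorem IsPolyCone.exists_add_of_inner_nonpos {d : ℕ} {C D : Set (Euc d)} (hC : IsPolyCone C)
    (hD : IsPolyCone D) {u : Euc d} (hu : ∀ y ∈ C ∩ D, ⟪u, y⟫ ≤ 0) :
    ∃ v w, u = v + w ∧ (∀ y ∈ C, ⟪v, y⟫ ≤ 0) ∧ ∀ y ∈ D, ⟪w, y⟫ ≤ 0 := by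
  classical
  obtain ⟨U, rfl⟩ := hC
  obtain ⟨V, rfl⟩ := hD
  obtain ⟨c, hc, rfl⟩ := exists_nonneg_sum_of_inner_nonpos (U ∪ V) id u (by
    intro x hx
    refine hu x ⟨?_, ?_⟩ <;> simp only [mem_iInter, mem_ofPred_eq] <;> intro v hv
    · exact hx v (Finset.mem_union_left _ hv)
    · exact hx v (Finset.mem_union_right _ hv))
  refine ⟨∑ i ∈ U, c i • i, ∑ i ∈ V \ U, c i • i, ?_, ?_, ?_⟩
  · rw [← Finset.union_sdiff_self_eq_union, Finset.sum_union Finset.disjoint_sdiff]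
    rfl
  all_goals
    intro y hy
    simp only [mem_iInter, mem_ofPred_eq] at hy
    rw [sum_inner]
    refine Finset.sum_nonpos fun v hv => ?_
    rw [real_inner_smul_left]
    refine mul_nonpos_of_nonneg_of_nonpos (hc v) (hy v ?_)
  · exact hv
  · exact (Finset.mem_sdiff.1 hv).1

/-- A segment ending in a point of the intrinsic interior can be prolonged within the set. -/
theorem exists_pos_add_smul_sub_mem {E : Type*} [NormedAddCommGroup E] [NormedSpace ℝ E]
    {s : Set E} {x y : E} (hx : x ∈ intrinsicInterior ℝ s) (hy : y ∈ s) :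
    ∃ ε : ℝ, 0 < ε ∧ x + ε • (x - y) ∈ s := by
  obtain ⟨z, hz, rfl⟩ := mem_intrinsicInterior.1 hx
  have hya : y ∈ affineSpan ℝ s := subset_affineSpan ℝ s hy
  let f : ℝ → affineSpan ℝ s := fun t => ⟨AffineMap.lineMap (z : E) y t,
    AffineMap.lineMap_mem t z.2 hya⟩
  have hf : Continuous f := Continuous.subtype_mk (AffineMap.lineMap_continuous) _
  have hf0 : f 0 = z := Subtype.ext (AffineMap.lineMap_apply_zero _ _)
  have hev : ∀ᶠ t in nhds (0 : ℝ), ((f t : affineSpan ℝ s) : E) ∈ s := by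
    have : (interior ((↑) ⁻¹' s : Set (affineSpan ℝ s))) ∈ nhds (f 0) := by
      rw [hf0]; exact isOpen_interior.mem_nhds hz
    filter_upwards [hf.continuousAt.preimage_mem_nhds this] with t ht
    exact interior_subset (s := ((↑) ⁻¹' s : Set (affineSpan ℝ s))) ht
  obtain ⟨δ, hδ, hball⟩ := Metric.eventually_nhds_iff.1 hev
  refine ⟨δ / 2, half_pos hδ, ?_⟩
  have := hball (y := -(δ / 2)) (by
    rw [dist_zero_right, norm_neg, Real.norm_of_nonneg (half_pos hδ).le]
    exact half_lt_self hδ)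
  convert this using 1
  simp only [f, AffineMap.lineMap_apply, vsub_eq_sub, vadd_eq_add]
  rw [neg_smul, ← smul_neg, neg_sub, add_comm]

/-- The normal cone of an intersection of polyhedral cones at the intersection of two faces whose
relative interiors meet is the sum of the normal cones. -/
theorem normalCone_inter {d : ℕ} {C D F G : Set (Euc d)} (hC : IsPolyCone C) (hD : IsPolyCone D)
    (hF : F ⊆ C) (hG : G ⊆ D)
    (hFG : (intrinsicInterior ℝ F ∩ intrinsicInterior ℝ G).Nonempty) :
    normalCone (C ∩ D) (F ∩ G) = normalCone C F + normalCone D G := by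
  obtain ⟨x, hxF, hxG⟩ := hFG
  have key : ∀ {K H : Set (Euc d)} {v : Euc d}, H ⊆ K → x ∈ intrinsicInterior ℝ H →
      (∀ y ∈ K, ⟪v, y⟫ ≤ 0) → ⟪v, x⟫ = 0 → v ∈ normalCone K H := by
    intro K H v hHK hx hv hvx
    refine ⟨hv, fun y hy => le_antisymm (hv y (hHK hy)) ?_⟩
    obtain ⟨ε, hε, hmem⟩ := exists_pos_add_smul_sub_mem hx hy
    have := hv _ (hHK hmem)
    rw [inner_add_right, inner_smul_right, inner_sub_right, hvx] at this
    by_contra! hneg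
    nlinarith [mul_pos hε (neg_pos.2 hneg)]
  ext u
  constructor
  · rintro ⟨hu, hu0⟩
    obtain ⟨v, w, rfl, hv, hw⟩ := hC.exists_add_of_inner_nonpos hD hu
    have hxF' := intrinsicInterior_subset hxF
    have hxG' := intrinsicInterior_subset hxG
    have h0 := hu0 x ⟨hxF', hxG'⟩
    rw [inner_add_left] at h0
    have h1 := hv x (hF hxF')
    have h2 := hw x (hG hxG')
    exact add_mem_add (key hF hxF hv (by linarith)) (key hG hxG hw (by linarith))
  · rintro ⟨v, hv, w, hw, rfl⟩
    refine ⟨fun y hy => ?_, fun y hy => ?_⟩ <;> simp only [inner_add_left]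
    · exact add_nonpos (hv.1 y hy.1) (hw.1 y hy.2)
    · rw [hv.2 y hy.1, hw.2 y hy.2, add_zero]

/-- A face of a set stable under nonnegative scaling is stable under nonnegative scaling. -/
theorem IsFace.smul_mem {d : ℕ} {C F : Set (Euc d)} (hF : IsFace C F)
    (hC : ∀ x ∈ C, ∀ r : ℝ, 0 ≤ r → r • x ∈ C) :
    ∀ x ∈ F, ∀ r : ℝ, 0 ≤ r → r • x ∈ F := by
  intro x hx r hr
  have hxC := hF.1.subset hx
  have h0 : (0 : Euc d) ∈ F := by
    refine hF.1.left_mem_of_mem_openSegment (by simpa using hC x hxC 0 le_rfl)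
      (hC x hxC 2 zero_le_two) hx ⟨1 / 2, 1 / 2, by norm_num, by norm_num, by norm_num, ?_⟩
    rw [smul_zero, zero_add, smul_smul]; norm_num
  have h1 : (r + 2) • x ∈ F := by
    refine hF.1.left_mem_of_mem_openSegment (hC x hxC _ (by positivity)) (hF.1.subset h0) hx
      ⟨1 / (r + 2), (r + 1) / (r + 2), by positivity, by positivity, by field_simp; ring, ?_⟩
    rw [smul_zero, add_zero, smul_smul, one_div_mul_cancel (by positivity), one_smul]
  have := hF.2.1 h1 h0 (show 0 ≤ r / (r + 2) by positivity) (show 0 ≤ 2 / (r + 2) by positivity)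
    (by field_simp)
  rw [smul_zero, add_zero, smul_smul] at this
  rwa [div_mul_cancel₀ _ (by positivity)] at this

theorem IsPolyCone.smul_mem {d : ℕ} {C : Set (Euc d)} (hC : IsPolyCone C) :
    ∀ x ∈ C, ∀ r : ℝ, 0 ≤ r → r • x ∈ C := by
  obtain ⟨U, rfl⟩ := hC
  intro x hx r hr
  simp only [mem_iInter, mem_ofPred_eq] at hx ⊢
  intro u hu
  rw [inner_smul_right]
  exact mul_nonpos_of_nonneg_of_nonpos hr (hx u hu)

/-- A face of a convex cone whose linear hull contains the cone is the whole cone. -/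
theorem IsFace.eq_of_subset_linHull {d : ℕ} {K H : Set (Euc d)} (hH : IsFace K H)
    (hK : ∀ x ∈ K, ∀ r : ℝ, 0 ≤ r → r • x ∈ K) (hKH : K ⊆ linHull H) : H = K := by
  refine hH.1.subset.antisymm fun x hx => ?_
  have hcone := hH.smul_mem hK
  have hadd : ∀ a ∈ H, ∀ b ∈ H, a + b ∈ H := by
    intro a ha b hb
    have := hH.2.1 (hcone a ha 2 zero_le_two) (hcone b hb 2 zero_le_two)
      (show (0 : ℝ) ≤ 1 / 2 by norm_num) (show (0 : ℝ) ≤ 1 / 2 by norm_num) (by norm_num)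
    rw [smul_smul, smul_smul] at this
    norm_num at this
    exact this
  have hdiff : ∀ y ∈ linHull H, ∃ a ∈ H, ∃ b ∈ H, y = a - b := by
    intro y hy
    have h0 : (0 : Euc d) ∈ H := by
      obtain ⟨z, hz⟩ := hH.2.2
      simpa using hcone z hz 0 le_rfl
    refine Submodule.span_induction (p := fun y _ => ∃ a ∈ H, ∃ b ∈ H, y = a - b) ?_ ?_ ?_ ?_ hy
    · exact fun z hz => ⟨z, hz, 0, h0, (sub_zero z).symm⟩
    · exact ⟨0, h0, 0, h0, (sub_zero 0).symm⟩
    · rintro _ _ - - ⟨a, ha, b, hb, rfl⟩ ⟨a', ha', b', hb', rfl⟩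
      exact ⟨a + a', hadd a ha a' ha', b + b', hadd b hb b' hb', by abel⟩
    · rintro r _ - ⟨a, ha, b, hb, rfl⟩
      rcases le_total 0 r with hr | hr
      · exact ⟨r • a, hcone a ha r hr, r • b, hcone b hb r hr, smul_sub _ _ _⟩
      · refine ⟨-r • b, hcone b hb _ (neg_nonneg.2 hr), -r • a, hcone a ha _ (neg_nonneg.2 hr), ?_⟩
        simp only [neg_smul, smul_sub]; abel
  obtain ⟨a, ha, b, hb, rfl⟩ := hdiff x (hKH hx)
  refine hH.1.left_mem_of_mem_openSegment hx (hH.1.subset hb) (hcone a ha (1 / 2) (by norm_num))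
    ⟨1 / 2, 1 / 2, by norm_num, by norm_num, by norm_num, ?_⟩
  rw [← smul_add, sub_add_cancel]

/-- The only face of a cone `K ⊆ L` of dimension `dim L` is `K` itself, and then `K` spans `L`. -/
theorem IsFaceDim.eq_and_linHull_eq {d : ℕ} {K H : Set (Euc d)}
    (hK : ∀ x ∈ K, ∀ r : ℝ, 0 ≤ r → r • x ∈ K) {L : Submodule ℝ (Euc d)} (hKL : K ⊆ L)
    (hH : IsFaceDim K H (Module.finrank ℝ L)) : H = K ∧ linHull K = L := by
  have hHL : linHull H = L :=
    Submodule.eq_of_le_of_finrank_eq (Submodule.span_le.2 (hH.1.1.subset.trans hKL)) hH.2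
  have := hH.1.eq_of_subset_linHull hK (by rw [hHL]; exact hKL)
  subst this
  exact ⟨rfl, hHL⟩

theorem tsum_isFaceDim_of_linHull_eq {d : ℕ} {K : Set (Euc d)} (hne : K.Nonempty)
    (hconv : Convex ℝ K) (hK : ∀ x ∈ K, ∀ r : ℝ, 0 ≤ r → r • x ∈ K)
    {L : Submodule ℝ (Euc d)} (hL : linHull K = L) (f : Set (Euc d) → ℝ≥0∞) :
    ∑' H : {H : Set (Euc d) // IsFaceDim K H (Module.finrank ℝ L)}, f H.1 = f K := by
  have hKL : K ⊆ L := hL ▸ Submodule.subset_span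
  have hKK : IsFaceDim K K (Module.finrank ℝ L) :=
    ⟨⟨IsExtreme.refl ℝ K, hconv, hne⟩, by rw [dimS, hL]⟩
  rw [tsum_eq_single ⟨K, hKK⟩]
  rintro ⟨H, hH⟩ hne
  exact absurd (Subtype.ext (hH.eq_and_linHull_eq hK hKL).1) hne

theorem tsum_isFaceDim_of_linHull_ne {d : ℕ} {K : Set (Euc d)}
    (hK : ∀ x ∈ K, ∀ r : ℝ, 0 ≤ r → r • x ∈ K) {L : Submodule ℝ (Euc d)} (hKL : K ⊆ L)
    (hL : linHull K ≠ L) (f : Set (Euc d) → ℝ≥0∞) :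
    ∑' H : {H : Set (Euc d) // IsFaceDim K H (Module.finrank ℝ L)}, f H.1 = 0 := by
  have : IsEmpty {H : Set (Euc d) // IsFaceDim K H (Module.finrank ℝ L)} :=
    ⟨fun H => hL (H.2.eq_and_linHull_eq hK hKL).2⟩
  simp

theorem normalCone_self {d : ℕ} (K : Set (Euc d)) : normalCone K K = (linHull K)ᗮ := by
  ext u
  rw [SetLike.mem_coe, Submodule.mem_orthogonal']
  constructor
  · rintro ⟨-, h⟩ y hy
    refine Submodule.span_induction (p := fun y _ => ⟪u, y⟫ = 0) (fun x hx => h x hx) (by simp)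
      ?_ ?_ hy
    · intro x y _ _ hx hy
      rw [inner_add_right, hx, hy, add_zero]
    · intro r x _ hx
      rw [inner_smul_right, hx, mul_zero]
  · intro h
    exact ⟨fun y hy => (h y (Submodule.subset_span hy)).le, fun y hy =>
      h y (Submodule.subset_span hy)⟩

theorem normalCone_subset_orthogonal_linHull {d : ℕ} (C F : Set (Euc d)) :
    normalCone C F ⊆ (linHull F)ᗮ := by
  rw [← normalCone_self]
  exact fun u hu => ⟨fun y hy => (hu.2 y hy).le, hu.2⟩

theorem normalCone_nonempty {d : ℕ} (C F : Set (Euc d)) : (normalCone C F).Nonempty :=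
  ⟨0, by simp [normalCone]⟩

theorem convex_normalCone {d : ℕ} (C F : Set (Euc d)) : Convex ℝ (normalCone C F) := by
  intro u hu v hv a b ha hb _
  refine ⟨fun y hy => ?_, fun y hy => ?_⟩ <;>
    simp only [inner_add_left, real_inner_smul_left]
  · exact add_nonpos (mul_nonpos_of_nonneg_of_nonpos ha (hu.1 y hy))
      (mul_nonpos_of_nonneg_of_nonpos hb (hv.1 y hy))
  · rw [hu.2 y hy, hv.2 y hy, mul_zero, mul_zero, add_zero]

theorem smul_mem_normalCone {d : ℕ} (C F : Set (Euc d)) :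
    ∀ u ∈ normalCone C F, ∀ r : ℝ, 0 ≤ r → r • u ∈ normalCone C F := by
  intro u hu r hr
  refine ⟨fun y hy => ?_, fun y hy => ?_⟩ <;> rw [real_inner_smul_left]
  · exact mul_nonpos_of_nonneg_of_nonpos hr (hu.1 y hy)
  · rw [hu.2 y hy, mul_zero]

section Gauss

variable {d : ℕ} (L : Submodule ℝ (Euc d))

theorem gauss_apply (S : Set (Euc d)) :
    gauss L S = (volume : Measure L).withDensity (fun x =>
      ENNReal.ofReal ((2 * Real.pi) ^ (-(Module.finrank ℝ L : ℝ) / 2) *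
        Real.exp (-‖(x : Euc d)‖ ^ 2 / 2))) (Subtype.val ⁻¹' S) :=
  (MeasurableEmbedding.subtype_coe
    (Submodule.closed_of_finiteDimensional L).measurableSet).map_apply _ _

theorem gauss_self : gauss L L = 1 := by
  have hint : ∫ x : L, (2 * Real.pi) ^ (-(Module.finrank ℝ L : ℝ) / 2) *
      Real.exp (-‖(x : Euc d)‖ ^ 2 / 2) = 1 := by
    have := GaussianFourier.integral_rexp_neg_mul_sq_norm (V := L) (b := 1 / 2) (by norm_num)
    rw [integral_const_mul]
    have h2 : (fun x : L => Real.exp (-‖(x : Euc d)‖ ^ 2 / 2)) =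
        fun x : L => Real.exp (-(1 / 2) * ‖x‖ ^ 2) := by
      funext x
      rw [Submodule.coe_norm]
      congr 1; ring
    rw [h2, this, show Real.pi / (1 / 2) = 2 * Real.pi by ring, ← Real.rpow_add (by positivity)]
    rw [neg_div, neg_add_cancel, Real.rpow_zero]
  rw [gauss_apply, Subtype.coe_preimage_self, withDensity_apply _ MeasurableSet.univ,
    Measure.restrict_univ, ← ofReal_integral_eq_lintegral_ofReal, hint, ENNReal.ofReal_one]
  · exact Integrable.of_integral_ne_zero (by rw [hint]; exact one_ne_zero)
  · exact Filter.Eventually.of_forall fun x => by positivity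

theorem gauss_eq_zero_of_linHull_ne {S : Set (Euc d)} (hS : S ⊆ L) (hne : linHull S ≠ L) :
    gauss L S = 0 := by
  rw [gauss_apply]
  refine withDensity_absolutelyContinuous _ _ ?_
  refine measure_mono_null (t := ((linHull S).comap L.subtype : Submodule ℝ L)) ?_ ?_
  · exact fun x hx => Submodule.subset_span hx
  · refine Measure.addHaar_submodule _ _ fun htop => hne ?_
    refine le_antisymm (Submodule.span_le.2 hS) ?_
    rwa [Submodule.comap_subtype_eq_top] at htop

/-- The standard Gaussian measure is the product of the Gaussian measures of two orthogonal
complementary subspaces. -/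
theorem stdGauss_add {S T : Set (Euc d)} (hS : S ⊆ L) (hT : T ⊆ Lᗮ) :
    stdGauss d (S + T) = gauss L S * gauss Lᗮ T := by
  let e := L.measurableEquivProd (0 : Euc d)
  have hmp : MeasurePreserving e.symm volume volume := by
    have := (L.orthogonalDecomposition.measurePreserving.symm
      (e := L.orthogonalDecomposition.toHomeomorph.toMeasurableEquiv)).comp
      (WithLp.volume_preserving_toLp L Lᗮ)
    have heq : (e.symm : L × Lᗮ → Euc d) =
        L.orthogonalDecomposition.toHomeomorph.toMeasurableEquiv.symm ∘ WithLp.toLp 2 := by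
      funext q
      change (L.measurableEquivProd (0 : Euc d)).symm q = L.orthogonalDecomposition.symm _
      simp
    rw [heq]
    exact this
  have he : ∀ q, e.symm q = (q.1 : Euc d) + q.2 := fun q => by simp [e]
  have hpre : e.symm ⁻¹' (S + T) = (Subtype.val ⁻¹' S) ×ˢ (Subtype.val ⁻¹' T) := by
    ext ⟨a, b⟩
    simp only [mem_preimage, he, mem_prod]
    constructor
    · rintro ⟨s, hs, t, ht, hst⟩
      have h1 : e.symm (⟨s, hS hs⟩, ⟨t, hT ht⟩) = e.symm (a, b) := by
        rw [he, he]; exact hst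
      obtain ⟨rfl, rfl⟩ := Prod.ext_iff.1 (e.symm.injective h1)
      exact ⟨hs, ht⟩
    · rintro ⟨ha, hb⟩
      exact add_mem_add ha hb
  have hmap : stdGauss d = Measure.map e.symm ((volume : Measure (L × Lᗮ)).withDensity fun q =>
      ENNReal.ofReal ((2 * Real.pi) ^ (-(d : ℝ) / 2) * Real.exp (-‖e.symm q‖ ^ 2 / 2))) := by
    ext s hs
    rw [e.symm.map_apply, withDensity_apply _ (e.symm.measurable hs), stdGauss,
      withDensity_apply _ hs, hmp.setLIntegral_comp_preimage_emb e.symm.measurableEmbedding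
        (fun x => ENNReal.ofReal ((2 * Real.pi) ^ (-(d : ℝ) / 2) * Real.exp (-‖x‖ ^ 2 / 2)))]
  have hd : (Module.finrank ℝ L : ℝ) + Module.finrank ℝ Lᗮ = d := by
    exact_mod_cast (L.finrank_add_finrank_orthogonal).trans finrank_euclideanSpace_fin
  rw [hmap, e.symm.map_apply, hpre, gauss_apply, gauss_apply, ← Measure.prod_prod,
    prod_withDensity (by fun_prop) (by fun_prop)]
  congr 2
  funext ⟨a, b⟩
  have hab : ‖(a : Euc d) + b‖ ^ 2 = ‖(a : Euc d)‖ ^ 2 + ‖(b : Euc d)‖ ^ 2 := by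
    have := norm_add_sq_eq_norm_sq_add_norm_sq_real
      (Submodule.inner_right_of_mem_orthogonal a.2 b.2)
    simpa only [sq] using this
  rw [he, hab, ← ENNReal.ofReal_mul (by positivity), mul_mul_mul_comm,
    ← Real.rpow_add (by positivity), ← Real.exp_add, ← hd]
  congr 3 <;> ring

end Gauss

/-- **Lemma 3.4.** For polyhedral cones `C, D ⊆ ℝ^d`, conic Borel sets `A, B`, an
`i`-dimensional face `F` of `C` and a `j`-dimensional face `G` of `D` with `i + j = d + k`,
`k > 0`: if `F ⋔ G`, then
`φ_{F∩G}(C ∩ D, A ∩ B) = Φ_k(F ∩ G, A ∩ B) ⬝ V_{d−k}(N(C,F) + N(D,G))`. -/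
theorem phiLoc_of_transverse_faces {d : ℕ} (C D A B : Set (Euc d))
    (hC : IsPolyCone C) (hD : IsPolyCone D)
    (hA : MeasurableSet A) (hAc : IsConic A) (hB : MeasurableSet B) (hBc : IsConic B)
    (F G : Set (Euc d)) (i j k : ℕ)
    (hF : IsFaceDim C F i) (hG : IsFaceDim D G j) (hijk : i + j = d + k) (hk : 0 < k)
    (hFG : Transverse F G) :
    phiLoc (C ∩ D) (F ∩ G) (A ∩ B)
      = Phi k (F ∩ G) (A ∩ B) * cV (d - k) (normalCone C F + normalCone D G) := by
  have hconeFG : ∀ x ∈ F ∩ G, ∀ r : ℝ, 0 ≤ r → r • x ∈ F ∩ G := fun x hx r hr =>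
    ⟨hF.1.smul_mem hC.smul_mem x hx.1 r hr, hG.1.smul_mem hD.smul_mem x hx.2 r hr⟩
  have hne : (F ∩ G).Nonempty :=
    hFG.2.mono (inter_subset_inter intrinsicInterior_subset intrinsicInterior_subset)
  set L := linHull (F ∩ G) with hL
  have hLk : Module.finrank ℝ L = k := by
    have h := hFG.1
    rw [hF.2, hG.2] at h
    change ((Module.finrank ℝ L : ℕ) : ℤ) = _ at h
    omega
  have hLk' : Module.finrank ℝ Lᗮ = d - k := by
    have h := L.finrank_add_finrank_orthogonal
    rw [finrank_euclideanSpace_fin] at h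
    omega
  have hsub : F ∩ G ⊆ L := Submodule.subset_span
  set N := normalCone (C ∩ D) (F ∩ G) with hN
  have hNL : N ⊆ Lᗮ := normalCone_subset_orthogonal_linHull _ _
  have hphi : Phi k (F ∩ G) (A ∩ B) = gauss L (F ∩ G ∩ (A ∩ B)) := by
    rw [← hLk, Phi, tsum_isFaceDim_of_linHull_eq hne (hF.1.2.1.inter hG.1.2.1) hconeFG hL.symm
      (fun H => gauss (linHull H) (H ∩ (A ∩ B)) * gauss (linHull H)ᗮ (normalCone (F ∩ G) H)),
      normalCone_self, gauss_self, mul_one]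
  have hcV : cV (d - k) N = gauss Lᗮ N := by
    rw [← hLk', cV]
    by_cases h : linHull N = Lᗮ
    · rw [tsum_isFaceDim_of_linHull_eq (normalCone_nonempty _ _) (convex_normalCone _ _)
        (smul_mem_normalCone _ _) h (fun H => stdGauss d (H + normalCone N H)), normalCone_self, h,
        Submodule.orthogonal_orthogonal, add_comm, stdGauss_add L Subset.rfl hNL, gauss_self,
        one_mul]
    · rw [tsum_isFaceDim_of_linHull_ne (smul_mem_normalCone _ _) hNL h
        (fun H => stdGauss d (H + normalCone N H)), gauss_eq_zero_of_linHull_ne _ hNL h]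
  rw [← normalCone_inter hC hD hF.1.1.subset hG.1.1.subset hFG.2, hphi, hcV, phiLoc,
    stdGauss_add L (inter_subset_right.trans hsub) hNL, inter_comm (A ∩ B)]
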